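/- Let p be a prime and m a positive integer; write m = p^k·μ with p ∤ μ. Then the degree of the cyclotomic extension ℚ_p(ζ_m) of the field ℚ_p of p-adic numbers, i.e. the dimension of ℚ_p(ζ_m) as a ℚ_p-vector space, equals φ(p^k)·d, where φ is Euler's totient function and d is the multiplicative order of p modulo μ. -/

import Mathlib

open Polynomial

namespace PadicInt

variable {p : ℕ} [Fact p.Prime]

section Local

variable {A F : Type*} [CommRing A] [IsDomain A] [Field F] [Algebra ℤ_[p] A] [Algebra ℤ_[p] F]
  [Algebra ℚ_[p] F] [Algebra A F] [IsScalarTower ℤ_[p] ℚ_[p] F] [IsScalarTower ℤ_[p] A F]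

theorem minpoly_algebraMap_eq_map {a : A} (ha : IsIntegral ℤ_[p] a) :
    minpoly ℚ_[p] (algebraMap A F a) = (minpoly ℤ_[p] a).map (algebraMap ℤ_[p] ℚ_[p]) :=
  minpoly.isIntegrallyClosed_eq_field_fractions ℚ_[p] F ha

theorem spectralNorm_algebraMap_le_one {a : A} (ha : IsIntegral ℤ_[p] a) :
    spectralNorm ℚ_[p] F (algebraMap A F a) ≤ 1 := by
  rw [spectralNorm, minpoly_algebraMap_eq_map ha,
    spectralValue_le_one_iff ((minpoly.monic ha).map _)]
  intro n
  rw [coeff_map]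
  exact norm_le_one _

variable [Algebra.IsAlgebraic ℚ_[p] F]

/-- An element integral over `ℤ_[p]` is a unit as soon as its spectral norm is one. -/
theorem isUnit_of_spectralNorm_eq_one {a : A} (ha : IsIntegral ℤ_[p] a)
    (h : spectralNorm ℚ_[p] F (algebraMap A F a) = 1) : IsUnit a := by
  have hn : (minpoly ℚ_[p] (algebraMap A F a)).natDegree ≠ 0 :=
    (minpoly.natDegree_pos (Algebra.IsIntegral.isIntegral _)).ne'
  rw [spectralNorm.spectralNorm_eq_norm_coeff_zero_rpow] at h
  replace h := (Real.rpow_left_inj (norm_nonneg _) zero_le_one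
    (one_div_ne_zero (Nat.cast_ne_zero.2 hn))).1 (h.trans (Real.one_rpow _).symm)
  rw [minpoly_algebraMap_eq_map ha, coeff_map] at h
  have hu : IsUnit ((minpoly ℤ_[p] a).coeff 0) := isUnit_iff.2 h
  have hz := minpoly.aeval ℤ_[p] a
  rw [← divX_mul_X_add (minpoly ℤ_[p] a), map_add, map_mul, aeval_X, aeval_C] at hz
  refine isUnit_of_dvd_unit ?_ (hu.map (algebraMap ℤ_[p] A))
  exact ⟨-aeval a (minpoly ℤ_[p] a).divX, by linear_combination hz⟩

/-- A domain integral over `ℤ_[p]` that embeds into an algebraic extension of `ℚ_[p]` is local. -/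
theorem isLocalRing_of_isIntegral (p : ℕ) [Fact p.Prime] (A F : Type*) [CommRing A] [IsDomain A]
    [Field F] [Algebra ℤ_[p] A] [Algebra ℤ_[p] F] [Algebra ℚ_[p] F] [Algebra A F]
    [IsScalarTower ℤ_[p] ℚ_[p] F] [IsScalarTower ℤ_[p] A F] [Algebra.IsAlgebraic ℚ_[p] F]
    [Algebra.IsIntegral ℤ_[p] A] : IsLocalRing A := by
  have key : ∀ a : A, a ∈ nonunits A ↔ spectralNorm ℚ_[p] F (algebraMap A F a) < 1 := by
    intro a
    have hle (x : A) : spectralNorm ℚ_[p] F (algebraMap A F x) ≤ 1 :=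
      spectralNorm_algebraMap_le_one (Algebra.IsIntegral.isIntegral x)
    refine ⟨fun h ↦ lt_of_le_of_ne (hle a) fun h1 ↦ h <|
      isUnit_of_spectralNorm_eq_one (Algebra.IsIntegral.isIntegral a) h1, fun h hu ↦ ?_⟩
    obtain ⟨b, hb⟩ := hu.exists_right_inv
    have hmul := spectralAlgNorm_mul (K := ℚ_[p]) (algebraMap A F a) (algebraMap A F b)
    rw [← map_mul, hb, map_one, spectralAlgNorm_one, spectralAlgNorm_def, spectralAlgNorm_def]
      at hmul
    nlinarith [hle b, spectralNorm_nonneg (K := ℚ_[p]) (algebraMap A F a)]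
  refine IsLocalRing.of_nonunits_add fun a b ha hb ↦ ?_
  rw [key] at ha hb ⊢
  rw [map_add]
  exact (isNonarchimedean_spectralNorm _ _).trans_lt (max_lt ha hb)

end Local

section Monogenic

variable {A : Type*} [CommRing A] [IsDomain A] [Algebra ℤ_[p] A] [Module.IsTorsionFree ℤ_[p] A]
  {z : A}

theorem map_toZMod_surjective : Function.Surjective (Polynomial.map (toZMod (p := p))) :=
  Polynomial.map_surjective _ (ZMod.ringHom_surjective _)

theorem toZMod_eq_zero_iff_dvd {x : ℤ_[p]} : toZMod x = 0 ↔ (p : ℤ_[p]) ∣ x := by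
  rw [← RingHom.mem_ker, ker_toZMod, maximalIdeal_eq_span_p, Ideal.mem_span_singleton]

theorem map_toZMod_eq_zero_iff_dvd {G : ℤ_[p][X]} :
    G.map toZMod = 0 ↔ C (p : ℤ_[p]) ∣ G := by
  rw [C_dvd_iff_dvd_coeff, Polynomial.ext_iff]
  simp [toZMod_eq_zero_iff_dvd]

omit [IsDomain A] [Module.IsTorsionFree ℤ_[p] A] in
theorem natDegree_map_toZMod_minpoly (hz : IsIntegral ℤ_[p] z) :
    ((minpoly ℤ_[p] z).map toZMod).natDegree = (minpoly ℤ_[p] z).natDegree :=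
  (minpoly.monic hz).natDegree_map _

omit [Module.IsTorsionFree ℤ_[p] A] in
theorem not_isUnit_map_toZMod_minpoly (hz : IsIntegral ℤ_[p] z) :
    ¬ IsUnit ((minpoly ℤ_[p] z).map (toZMod (p := p))) :=
  not_isUnit_of_natDegree_pos _ <| by
    rw [natDegree_map_toZMod_minpoly hz]; exact minpoly.natDegree_pos hz

omit [IsDomain A] [Module.IsTorsionFree ℤ_[p] A] in
theorem p_dvd_aeval_of_minpoly_dvd {G : ℤ_[p][X]}
    (h : (minpoly ℤ_[p] z).map toZMod ∣ G.map toZMod) : (p : A) ∣ aeval z G := by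
  obtain ⟨q, hq⟩ := h
  obtain ⟨Q, rfl⟩ := map_toZMod_surjective q
  rw [← Polynomial.map_mul, ← sub_eq_zero, ← Polynomial.map_sub, map_toZMod_eq_zero_iff_dvd] at hq
  obtain ⟨R, hR⟩ := hq
  refine ⟨aeval z R, ?_⟩
  simpa using congrArg (aeval z) hR

theorem not_isUnit_aeval_of_dvd (hz : IsIntegral ℤ_[p] z) (hgen : Algebra.adjoin ℤ_[p] {z} = ⊤)
    {G : ℤ_[p][X]} {h : (ZMod p)[X]} (hu : ¬ IsUnit h) (h1 : h ∣ (minpoly ℤ_[p] z).map toZMod)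
    (h2 : h ∣ G.map toZMod) : ¬ IsUnit (aeval z G) := by
  intro hG
  obtain ⟨b, hb⟩ := hG.exists_right_inv
  obtain ⟨B, rfl⟩ : ∃ B : ℤ_[p][X], aeval z B = b := by
    rw [← AlgHom.mem_range, ← Algebra.adjoin_singleton_eq_range_aeval, hgen]; trivial
  have h3 : minpoly ℤ_[p] z ∣ G * B - 1 :=
    minpoly.isIntegrallyClosed_dvd hz (by simp [hb])
  have h4 := h1.trans (Polynomial.map_dvd toZMod h3)
  rw [Polynomial.map_sub, Polynomial.map_mul, Polynomial.map_one] at h4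
  refine hu (isUnit_of_dvd_one ?_)
  simpa using dvd_sub (h2.mul_right (B.map toZMod)) h4

theorem not_isUnit_p (hz : IsIntegral ℤ_[p] z) (hgen : Algebra.adjoin ℤ_[p] {z} = ⊤) :
    ¬ IsUnit (p : A) := by
  simpa using not_isUnit_aeval_of_dvd hz hgen (G := C (p : ℤ_[p]))
    (not_isUnit_map_toZMod_minpoly hz) dvd_rfl (by simp)

variable [IsLocalRing A]

theorem irreducible_map_toZMod_minpoly (hz : IsIntegral ℤ_[p] z)
    (hgen : Algebra.adjoin ℤ_[p] {z} = ⊤)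
    (hsq : Squarefree ((minpoly ℤ_[p] z).map (toZMod (p := p)))) :
    Irreducible ((minpoly ℤ_[p] z).map (toZMod (p := p))) := by
  refine ⟨not_isUnit_map_toZMod_minpoly hz, fun a b hab ↦ ?_⟩
  by_contra! hcon
  obtain ⟨ha, hb⟩ := hcon
  obtain ⟨u, v, huv⟩ : IsCoprime a b := by
    rw [hab] at hsq
    exact (squarefree_mul_iff.1 hsq).1.isCoprime
  obtain ⟨H, rfl⟩ := map_toZMod_surjective a
  obtain ⟨B, rfl⟩ := map_toZMod_surjective b
  obtain ⟨U, rfl⟩ := map_toZMod_surjective u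
  obtain ⟨V, rfl⟩ := map_toZMod_surjective v
  have h1 : aeval z (U * H) ∈ nonunits A :=
    not_isUnit_aeval_of_dvd hz hgen ha (hab ▸ dvd_mul_right _ _) (by simp)
  have h2 : aeval z (V * B) ∈ nonunits A :=
    not_isUnit_aeval_of_dvd hz hgen hb (hab ▸ dvd_mul_left _ _) (by simp)
  have h3 : (p : A) ∣ aeval z (U * H + V * B - 1) :=
    p_dvd_aeval_of_minpoly_dvd (by simp [huv])
  obtain ⟨c, hc⟩ := h3
  have h4 : (p : A) * c ∈ nonunits A := fun h ↦
    not_isUnit_p hz hgen (isUnit_of_mul_isUnit_left h)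
  rw [← IsLocalRing.mem_maximalIdeal] at h1 h2 h4
  have h5 := sub_mem (add_mem h1 h2) h4
  rw [← hc, map_sub, map_add, map_one, sub_sub_cancel] at h5
  exact (Ideal.ne_top_iff_one _).1 (IsLocalRing.maximalIdeal.isMaximal A).ne_top h5

theorem maximalIdeal_eq_span_p_of_squarefree (hz : IsIntegral ℤ_[p] z)
    (hgen : Algebra.adjoin ℤ_[p] {z} = ⊤)
    (hsq : Squarefree ((minpoly ℤ_[p] z).map (toZMod (p := p)))) :
    IsLocalRing.maximalIdeal A = Ideal.span {(p : A)} := by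
  have hirr := irreducible_map_toZMod_minpoly hz hgen hsq
  refine le_antisymm (fun x hx ↦ ?_) ?_
  · rw [Ideal.mem_span_singleton]
    obtain ⟨G, rfl⟩ : ∃ G : ℤ_[p][X], aeval z G = x := by
      rw [← AlgHom.mem_range, ← Algebra.adjoin_singleton_eq_range_aeval, hgen]; trivial
    refine p_dvd_aeval_of_minpoly_dvd ?_
    by_contra hnd
    obtain ⟨u, v, huv⟩ := (hirr.coprime_iff_not_dvd.2 hnd)
    obtain ⟨V, rfl⟩ := map_toZMod_surjective v
    have h3 : (p : A) ∣ aeval z (V * G - 1) := by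
      refine p_dvd_aeval_of_minpoly_dvd ⟨-u, ?_⟩
      simp only [Polynomial.map_sub, Polynomial.map_mul, Polynomial.map_one]
      linear_combination huv
    obtain ⟨c, hc⟩ := h3
    have h4 : (p : A) * c ∈ IsLocalRing.maximalIdeal A := fun h ↦
      not_isUnit_p hz hgen (isUnit_of_mul_isUnit_left h)
    have h5 := sub_mem (Ideal.mul_mem_left _ (aeval z V) hx) h4
    rw [← hc, map_sub, map_mul, map_one, sub_sub_cancel] at h5
    exact (Ideal.ne_top_iff_one _).1 (IsLocalRing.maximalIdeal.isMaximal A).ne_top h5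
  · rw [Ideal.span_singleton_le_iff_mem]
    exact not_isUnit_p hz hgen

end Monogenic

end PadicInt

section Eisenstein

variable {p : ℕ} [Fact p.Prime] {A F : Type*} [CommRing A] [IsDomain A] [IsIntegrallyClosed A]
  [Field F] [Algebra A F] [IsFractionRing A F]

theorem Polynomial.irreducible_cyclotomic_prime_pow_of_prime (hp : Prime (p : A)) (k : ℕ) :
    Irreducible (cyclotomic (p ^ k) F) := by
  cases k with
  | zero => simpa using irreducible_X_sub_C (1 : F)
  | succ n =>
    set f : A[X] := (cyclotomic (p ^ (n + 1)) A).comp (X + 1) with hf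
    have hmonic : f.Monic := by
      rw [hf, ← C_1]
      exact (cyclotomic.monic _ A).comp_X_add_C 1
    have hmap : f = ((cyclotomic (p ^ (n + 1)) ℤ).comp (X + 1)).map (Int.castRingHom A) := by
      simp [hf, Polynomial.map_comp]
    have hprime : (Ideal.span {(p : A)}).IsPrime := (Ideal.span_singleton_prime hp.ne_zero).2 hp
    have hdeg : f.natDegree = ((cyclotomic (p ^ (n + 1)) ℤ).comp (X + 1)).natDegree := by
      rw [hf, ← C_1, natDegree_comp, natDegree_cyclotomic, ← C_1, natDegree_comp,
        natDegree_cyclotomic, natDegree_X_add_C, natDegree_X_add_C]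
    have heis : f.IsEisensteinAt (Ideal.span {(p : A)}) := by
      refine hmonic.isEisensteinAt_of_mem_of_notMem hprime.ne_top (fun {i} hi ↦ ?_) ?_
      · have := (cyclotomic_prime_pow_comp_X_add_one_isEisensteinAt p n).mem (hdeg ▸ hi)
        rw [Ideal.submodule_span_eq, Ideal.mem_span_singleton] at this
        rw [hmap, coeff_map, Ideal.mem_span_singleton]
        obtain ⟨c, hc⟩ := this
        exact ⟨c, by simp [hc]⟩
      · rw [hf, coeff_zero_eq_eval_zero, eval_comp]
        simp only [eval_add, eval_X, eval_one, zero_add]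
        rw [eval_one_cyclotomic_prime_pow, Ideal.span_singleton_pow, Ideal.mem_span_singleton]
        rintro ⟨c, hc⟩
        refine hp.not_isUnit (IsUnit.of_mul_eq_one c (mul_left_cancel₀ hp.ne_zero ?_))
        linear_combination -hc
    have hpos : 0 < f.natDegree := by
      rw [hf, ← C_1, natDegree_comp, natDegree_cyclotomic, natDegree_X_add_C, mul_one]
      exact Nat.totient_pos.2 (pow_pos (Fact.out : p.Prime).pos _)
    have hirr := (hmonic.irreducible_iff_irreducible_map_fraction_map (K := F)).1
      (heis.irreducible hprime hmonic.isPrimitive hpos)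
    have : f.map (algebraMap A F) = algEquivAevalXAddC 1 (cyclotomic (p ^ (n + 1)) F) := by
      rw [hf, Polynomial.map_comp]
      simp [algEquivAevalXAddC, comp, aeval_def, algebraMap_eq]
    rw [this] at hirr
    exact (MulEquiv.irreducible_iff _).1 hirr

end Eisenstein

theorem Algebra.isFractionRing_adjoin {R K F : Type*} [CommRing R] [IsDomain R] [Field K]
    [Algebra R K] [IsFractionRing R K] [Field F] [Algebra R F] [Algebra K F] [IsScalarTower R K F]
    {s : Set F} (hs : Algebra.adjoin K s = ⊤) : IsFractionRing (Algebra.adjoin R s) F := by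
  refine IsFractionRing.of_field _ _ fun x ↦ ?_
  have hx : x ∈ Algebra.adjoin K s := hs ▸ trivial
  suffices ∃ a b : Algebra.adjoin R s, (b : F) ≠ 0 ∧ x = a / b by
    obtain ⟨a, b, -, h⟩ := this
    exact ⟨a, b, h⟩
  induction hx using Algebra.adjoin_induction with
  | mem x hx => exact ⟨⟨x, Algebra.subset_adjoin hx⟩, 1, by simp, by simp⟩
  | algebraMap r =>
    obtain ⟨a, b, hb, rfl⟩ := IsFractionRing.div_surjective (A := R) r
    refine ⟨algebraMap R _ a, algebraMap R _ b, ?_, ?_⟩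
    · rw [Subalgebra.coe_algebraMap, IsScalarTower.algebraMap_apply R K F]
      simpa using nonZeroDivisors.ne_zero hb
    · simp [IsScalarTower.algebraMap_apply R K F]
  | add x y _ _ hx hy =>
    obtain ⟨a, b, hb, rfl⟩ := hx
    obtain ⟨c, d, hd, rfl⟩ := hy
    exact ⟨a * d + b * c, b * d, by simp_all, by simp [div_add_div _ _ hb hd]⟩
  | mul x y _ _ hx hy =>
    obtain ⟨a, b, hb, rfl⟩ := hx
    obtain ⟨c, d, hd, rfl⟩ := hy
    exact ⟨a * c, b * d, by simp_all, by simp [div_mul_div_comm]⟩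

section Unramified

variable {p : ℕ} [Fact p.Prime] {F : Type*} [Field F] [Algebra ℚ_[p] F] {n : ℕ} {ζ : F}

/-- For `n` prime to `p`, the field `ℚ_[p](ζ_n)` has the multiplicative order of `p` modulo `n`
as its degree, and `p` stays prime in it: the `p ^ k`-th cyclotomic polynomials are irreducible. -/
theorem IsPrimitiveRoot.natDegree_minpoly_padic_and_irreducible_cyclotomic
    (hn : ¬ p ∣ n) (hζ : IsPrimitiveRoot ζ n) (hF : Algebra.adjoin ℚ_[p] {ζ} = ⊤) :
    (minpoly ℚ_[p] ζ).natDegree = orderOf (p : ZMod n) ∧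
      ∀ k, Irreducible (cyclotomic (p ^ k) F) := by
  have hp : p.Prime := Fact.out
  have hn0 : 0 < n := Nat.pos_of_ne_zero fun h ↦ hn (h ▸ dvd_zero p)
  let : Algebra ℤ_[p] F := ((algebraMap ℚ_[p] F).comp (algebraMap ℤ_[p] ℚ_[p])).toAlgebra
  have : IsScalarTower ℤ_[p] ℚ_[p] F := IsScalarTower.of_algebraMap_eq fun _ ↦ rfl
  have hinj : Function.Injective (algebraMap ℤ_[p] F) :=
    (algebraMap ℚ_[p] F).injective.comp (IsFractionRing.injective ℤ_[p] ℚ_[p])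
  have : CharZero F := charZero_of_injective_algebraMap (algebraMap ℚ_[p] F).injective
  have hζint : IsIntegral ℤ_[p] ζ := (hζ.isIntegral hn0).tower_top
  have : Algebra.IsAlgebraic ℚ_[p] F := by
    have : Algebra.IsIntegral ℚ_[p] (⊤ : Subalgebra ℚ_[p] F) :=
      hF ▸ Algebra.IsIntegral.adjoin (by simpa using hζint.tower_top)
    exact ⟨fun x ↦ (Subalgebra.isAlgebraic_iff (⊤ : Subalgebra ℚ_[p] F)).2
      Algebra.IsIntegral.isAlgebraic x trivial⟩
  let A := Algebra.adjoin ℤ_[p] {ζ}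
  have : Module.Finite ℤ_[p] A := Algebra.finite_adjoin_simple_of_isIntegral hζint
  have : IsNoetherianRing A := IsNoetherianRing.of_finite ℤ_[p] A
  have : FaithfulSMul ℤ_[p] F := (faithfulSMul_iff_algebraMap_injective _ _).2 hinj
  have : Module.IsTorsionFree ℤ_[p] A := inferInstance
  have : IsFractionRing A F := Algebra.isFractionRing_adjoin hF
  have : IsLocalRing A := PadicInt.isLocalRing_of_isIntegral p A F
  let z : A := ⟨ζ, Algebra.self_mem_adjoin_singleton _ _⟩
  have hz : IsIntegral ℤ_[p] z := Algebra.IsIntegral.isIntegral z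
  have hgen : Algebra.adjoin ℤ_[p] {z} = ⊤ := by
    have := (Algebra.adjoin.powerBasis' hζint).adjoin_gen_eq_top
    rwa [Algebra.adjoin.powerBasis'_gen] at this
  have hzroot : IsPrimitiveRoot z n :=
    .of_map_of_injective (f := algebraMap A F) hζ Subtype.val_injective
  have hdvd : (minpoly ℤ_[p] z).map PadicInt.toZMod ∣ cyclotomic n (ZMod p) := by
    rw [← map_cyclotomic n (PadicInt.toZMod (p := p))]
    refine Polynomial.map_dvd _ (minpoly.isIntegrallyClosed_dvd hz ?_)
    rw [aeval_def, eval₂_eq_eval_map, map_cyclotomic]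
    exact hzroot.isRoot_cyclotomic hn0
  have : NeZero (n : ZMod p) := ⟨by rwa [Ne, ZMod.natCast_eq_zero_iff]⟩
  have hsq := (squarefree_cyclotomic n (ZMod p)).squarefree_of_dvd hdvd
  have hirr := PadicInt.irreducible_map_toZMod_minpoly hz hgen hsq
  constructor
  · have hcop : p.Coprime n := (hp.coprime_iff_not_dvd).2 hn
    have := natDegree_of_dvd_cyclotomic_of_irreducible (K := ZMod p) (f := 1) (by simp) hcop
      hdvd hirr
    rw [PadicInt.natDegree_map_toZMod_minpoly hz] at this
    have h2 := PadicInt.minpoly_algebraMap_eq_map (F := F) hz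
    rw [show algebraMap A F z = ζ from rfl] at h2
    rw [h2, (minpoly.monic hz).natDegree_map, this, ← orderOf_units]
    simp
  · have hmax := PadicInt.maximalIdeal_eq_span_p_of_squarefree hz hgen hsq
    have hp0 : (p : A) ≠ 0 := fun h ↦ hp.ne_zero <| by
      simpa using congrArg (algebraMap A F) h
    have hpp : Prime (p : A) := by
      rw [← Ideal.span_singleton_prime hp0, ← hmax]
      infer_instance
    have hnf : ¬ IsField A := fun h ↦ hpp.not_isUnit <| by
      let := h.toField
      exact isUnit_iff_ne_zero.2 hp0
    have hprin : (IsLocalRing.maximalIdeal A).IsPrincipal := hmax ▸ ⟨⟨(p : A), rfl⟩⟩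
    have : IsDiscreteValuationRing A := ((IsDiscreteValuationRing.TFAE A hnf).out 4 0).1 hprin
    exact irreducible_cyclotomic_prime_pow_of_prime hpp

end Unramified

/-- The degree of the cyclotomic extension `ℚ_p(ζ_m)/ℚ_p`, for `m = p^k * μ` with
`p ∤ μ`, is `φ(p^k) * d` where `d` is the multiplicative order of `p` modulo `μ`. -/
theorem finrank_padic_cyclotomic
    (p : ℕ) [Fact p.Prime] (m k μ : ℕ) (hm : m = p ^ k * μ) (hμ : ¬ p ∣ μ)
    (K : Type) [Field K] [Algebra ℚ_[p] K]
    (ζ : K) (hζ : IsPrimitiveRoot ζ m) (hK : Algebra.adjoin ℚ_[p] {ζ} = ⊤) :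
    Module.finrank ℚ_[p] K = Nat.totient (p ^ k) * orderOf (p : ZMod μ) := by
  have hp : p.Prime := Fact.out
  have hμ0 : 0 < μ := Nat.pos_of_ne_zero fun h ↦ hμ (h ▸ dvd_zero p)
  have hpk : 0 < p ^ k := pow_pos hp.pos k
  have hm0 : 0 < m := hm ▸ Nat.mul_pos hpk hμ0
  have : CharZero K := charZero_of_injective_algebraMap (algebraMap ℚ_[p] K).injective
  have hη : IsPrimitiveRoot (ζ ^ p ^ k) μ := hζ.pow hm0 hm
  have hξ : IsPrimitiveRoot (ζ ^ μ) (p ^ k) := hζ.pow hm0 (hm.trans (mul_comm _ _))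
  have hηint : IsIntegral ℚ_[p] (ζ ^ p ^ k) := (hη.isIntegral hμ0).tower_top
  let F := IntermediateField.adjoin ℚ_[p] {ζ ^ p ^ k}
  let η : F := IntermediateField.AdjoinSimple.gen ℚ_[p] (ζ ^ p ^ k)
  have hη' : IsPrimitiveRoot η μ :=
    .of_map_of_injective (f := algebraMap F K) hη Subtype.val_injective
  have hηtop : Algebra.adjoin ℚ_[p] {η} = ⊤ := by
    have := (IntermediateField.adjoin.powerBasis hηint).adjoin_gen_eq_top
    rwa [IntermediateField.adjoin.powerBasis_gen] at this
  obtain ⟨hdeg, hirr⟩ :=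
    hη'.natDegree_minpoly_padic_and_irreducible_cyclotomic hμ hηtop
  have hF : Module.finrank ℚ_[p] F = orderOf (p : ZMod μ) := by
    rw [IntermediateField.adjoin.finrank hηint, ← hdeg, IntermediateField.minpoly_gen]
  have hξint : IsIntegral F (ζ ^ μ) := (hξ.isIntegral hpk).tower_top
  have hmin : cyclotomic (p ^ k) F = minpoly F (ζ ^ μ) := by
    refine minpoly.eq_of_irreducible_of_monic (hirr k) ?_ (cyclotomic.monic _ _)
    rw [aeval_def, eval₂_eq_eval_map, map_cyclotomic]
    exact hξ.isRoot_cyclotomic hpk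
  have hζmem : ζ ∈ IntermediateField.adjoin F {ζ ^ μ} := by
    have hcop : IsCoprime ((p ^ k : ℕ) : ℤ) (μ : ℤ) :=
      Nat.isCoprime_iff_coprime.2 ((hp.coprime_iff_not_dvd.2 hμ).pow_left k)
    obtain ⟨a, b, hab⟩ := hcop
    have hζ0 : ζ ≠ 0 := hζ.ne_zero hm0.ne'
    have : (ζ ^ p ^ k) ^ a * (ζ ^ μ) ^ b = ζ := by
      rw [← zpow_natCast, ← zpow_natCast, ← zpow_mul, ← zpow_mul, ← zpow_add₀ hζ0,
        mul_comm _ a, mul_comm _ b, hab, zpow_one]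
    have hmem : (ζ ^ p ^ k) ^ a * (ζ ^ μ) ^ b ∈ IntermediateField.adjoin F {ζ ^ μ} :=
      mul_mem (zpow_mem (algebraMap_mem _ η) a)
      (zpow_mem (IntermediateField.mem_adjoin_simple_self F _) b)
    rwa [this] at hmem
  have htop : IntermediateField.adjoin F {ζ ^ μ} = ⊤ := by
    refine eq_top_iff.2 fun x _ ↦ ?_
    have hle : Algebra.adjoin ℚ_[p] {ζ} ≤
        ((IntermediateField.adjoin F {ζ ^ μ}).restrictScalars ℚ_[p]).toSubalgebra :=
      Algebra.adjoin_le (by simpa using hζmem)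
    exact hle (hK ▸ trivial)
  have hKF : Module.finrank F K = Nat.totient (p ^ k) := by
    rw [← IntermediateField.finrank_top', ← htop, IntermediateField.adjoin.finrank hξint, ← hmin,
      natDegree_cyclotomic]
  rw [← Module.finrank_mul_finrank ℚ_[p] F K, hF, hKF, mul_comm]
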